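/- Let P_{2k+1} be the path graph of odd order 2k+1 (k ≥ 1). For any finite simple graph G of minimum degree at least 1, γo(G □ P_{2k+1}) > γo(G)·γo(P_{2k+1}), where γo denotes the global offensive alliance number. -/

import Mathlib

open SimpleGraph

/-- `S` is a global offensive alliance in `G`: every vertex outside `S` has at least
one more neighbor inside `S` than outside `S`. -/
def IsGlobalOffensiveAlliance {V : Type*} (G : SimpleGraph V) (S : Set V) : Prop :=
  ∀ v ∉ S, (G.neighborSet v ∩ S).ncard ≥ (G.neighborSet v \ S).ncard + 1

/-- `S` is a global strong offensive alliance in `G`. -/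
def IsGlobalStrongOffensiveAlliance {V : Type*} (G : SimpleGraph V) (S : Set V) : Prop :=
  ∀ v ∉ S, (G.neighborSet v ∩ S).ncard ≥ (G.neighborSet v \ S).ncard

/-- The global offensive alliance number `γₒ(G)`. -/
noncomputable def globalOffensiveAllianceNumber {V : Type*} (G : SimpleGraph V) : ℕ :=
  sInf {n | ∃ S : Set V, IsGlobalOffensiveAlliance G S ∧ S.ncard = n}

/-- `S` is a dominating set in `G`. -/
def IsDominatingSet {V : Type*} (G : SimpleGraph V) (S : Set V) : Prop :=
  ∀ v ∉ S, ∃ u ∈ S, G.Adj u v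

/-- The domination number `γ(G)`. -/
noncomputable def dominationNumber {V : Type*} (G : SimpleGraph V) : ℕ :=
  sInf {n | ∃ S : Set V, IsDominatingSet G S ∧ S.ncard = n}

/-- `S` is an efficient dominating set: a dominating set whose closed neighborhoods
are pairwise disjoint. -/
def IsEfficientDominatingSet {V : Type*} (G : SimpleGraph V) (S : Set V) : Prop :=
  IsDominatingSet G S ∧
    S.Pairwise fun u w =>
      Disjoint (insert u (G.neighborSet u)) (insert w (G.neighborSet w))

theorem globalOffensiveAllianceNumber_le {V : Type*} {G : SimpleGraph V} {S : Set V}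
    (hS : IsGlobalOffensiveAlliance G S) : globalOffensiveAllianceNumber G ≤ S.ncard :=
  Nat.sInf_le ⟨S, hS, rfl⟩

theorem exists_isGlobalOffensiveAlliance_ncard_eq {V : Type*} (G : SimpleGraph V) :
    ∃ S : Set V, IsGlobalOffensiveAlliance G S ∧ S.ncard = globalOffensiveAllianceNumber G :=
  Nat.sInf_mem (s := {n | ∃ S : Set V, IsGlobalOffensiveAlliance G S ∧ S.ncard = n})
    ⟨_, Set.univ, fun v hv => absurd (Set.mem_univ v) hv, rfl⟩

/-- The neighbors of `(v, i)` in a box product lying in `T` split into those in the layer of `i`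
and those in the fiber over `v`. -/
theorem ncard_boxProd_neighborSet_inter {V W : Type*} [Finite V] [Finite W] (G : SimpleGraph V)
    (H : SimpleGraph W) (T : Set (V × W)) (v : V) (i : W) :
    ((G.boxProd H).neighborSet (v, i) ∩ T).ncard =
      (G.neighborSet v ∩ {u | (u, i) ∈ T}).ncard + (H.neighborSet i ∩ {j | (v, j) ∈ T}).ncard := by
  have hunion : (G.boxProd H).neighborSet (v, i) ∩ T =
      (fun u => (u, i)) '' (G.neighborSet v ∩ {u | (u, i) ∈ T}) ∪
        (fun j => (v, j)) '' (H.neighborSet i ∩ {j | (v, j) ∈ T}) := by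
    ext ⟨u, j⟩
    simp only [Set.mem_inter_iff, mem_neighborSet, boxProd_adj, Set.mem_union, Set.mem_image,
      Set.mem_ofPred_eq, Prod.mk.injEq]
    constructor
    · rintro ⟨⟨h, rfl⟩ | ⟨h, rfl⟩, hT⟩
      · exact Or.inl ⟨u, ⟨h, hT⟩, rfl, rfl⟩
      · exact Or.inr ⟨j, ⟨h, hT⟩, rfl, rfl⟩
    · rintro (⟨u, ⟨h, hT⟩, rfl, rfl⟩ | ⟨j, ⟨h, hT⟩, rfl, rfl⟩)
      · exact ⟨Or.inl ⟨h, rfl⟩, hT⟩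
      · exact ⟨Or.inr ⟨h, rfl⟩, hT⟩
  have hdisj : Disjoint ((fun u => (u, i)) '' (G.neighborSet v ∩ {u | (u, i) ∈ T}))
      ((fun j => (v, j)) '' (H.neighborSet i ∩ {j | (v, j) ∈ T})) := by
    rw [Set.disjoint_left]
    rintro _ ⟨u, ⟨hu, -⟩, rfl⟩ ⟨j, -, hj⟩
    obtain rfl : v = u := congrArg Prod.fst hj
    exact G.irrefl hu
  rw [hunion, Set.ncard_union_eq hdisj,
    Set.ncard_image_of_injective _ fun _ _ h => congrArg Prod.fst h,
    Set.ncard_image_of_injective _ fun _ _ h => congrArg Prod.snd h]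

theorem IsGlobalOffensiveAlliance.boxProd_ineq {V W : Type*} [Finite V] [Finite W]
    {G : SimpleGraph V} {H : SimpleGraph W} {S : Set (V × W)}
    (hS : IsGlobalOffensiveAlliance (G.boxProd H) S) {v : V} {i : W} (hv : (v, i) ∉ S) :
    (G.neighborSet v \ {u | (u, i) ∈ S}).ncard + (H.neighborSet i \ {j | (v, j) ∈ S}).ncard <
      (G.neighborSet v ∩ {u | (u, i) ∈ S}).ncard +
        (H.neighborSet i ∩ {j | (v, j) ∈ S}).ncard := by
  have h := hS _ hv
  rw [Set.sdiff_eq, ncard_boxProd_neighborSet_inter, ncard_boxProd_neighborSet_inter] at h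
  exact h

/-- If `i` has degree at most two in `H`, the union of the layers of `i` and of a neighbor `j`
projects to a global offensive alliance of `G`. -/
theorem IsGlobalOffensiveAlliance.union_layers {V W : Type*} [Finite V] [Finite W]
    {G : SimpleGraph V} {H : SimpleGraph W} {S : Set (V × W)}
    (hS : IsGlobalOffensiveAlliance (G.boxProd H) S) {i j : W} (hij : H.Adj i j)
    (hdeg : (H.neighborSet i).ncard ≤ 2) :
    IsGlobalOffensiveAlliance G ({v | (v, i) ∈ S} ∪ {v | (v, j) ∈ S}) := by
  intro v hv
  simp only [Set.mem_union, Set.mem_ofPred_eq, not_or] at hv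
  have h := hS.boxProd_ineq hv.1
  have hsum := Set.ncard_inter_add_ncard_sdiff_eq_ncard (H.neighborSet i) {l | (v, l) ∈ S}
  have hpos : 0 < (H.neighborSet i \ {l | (v, l) ∈ S}).ncard :=
    (Set.ncard_pos (Set.toFinite _)).2 ⟨j, hij, hv.2⟩
  have hin : (G.neighborSet v ∩ {u | (u, i) ∈ S}).ncard ≤
      (G.neighborSet v ∩ ({u | (u, i) ∈ S} ∪ {u | (u, j) ∈ S})).ncard :=
    Set.ncard_le_ncard (Set.inter_subset_inter_right _ Set.subset_union_left)
  have hout : (G.neighborSet v \ ({u | (u, i) ∈ S} ∪ {u | (u, j) ∈ S})).ncard ≤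
      (G.neighborSet v \ {u | (u, i) ∈ S}).ncard :=
    Set.ncard_le_ncard (Set.sdiff_subset_sdiff_right Set.subset_union_left)
  omega

/-- A global offensive alliance of a box product meets the layer of every vertex of degree at most
one, if the first factor has no isolated vertices. -/
theorem IsGlobalOffensiveAlliance.layer_nonempty {V W : Type*} [Finite V] [Nonempty V] [Finite W]
    {G : SimpleGraph V} {H : SimpleGraph W} {S : Set (V × W)}
    (hS : IsGlobalOffensiveAlliance (G.boxProd H) S) (hG : ∀ v : V, ∃ u : V, G.Adj v u) {i : W}
    (hdeg : (H.neighborSet i).ncard ≤ 1) : {v | (v, i) ∈ S}.Nonempty := by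
  by_contra hne
  rw [Set.not_nonempty_iff_eq_empty] at hne
  obtain ⟨v⟩ := ‹Nonempty V›
  have hv : (v, i) ∉ S := fun hv => (Set.eq_empty_iff_forall_notMem.1 hne) v hv
  obtain ⟨u, hu⟩ := hG v
  have h := hS.boxProd_ineq hv
  rw [hne, Set.sdiff_empty, Set.inter_empty, Set.ncard_empty] at h
  have hpos : 0 < (G.neighborSet v).ncard := (Set.ncard_pos (Set.toFinite _)).2 ⟨u, hu⟩
  have hle := Set.ncard_inter_le_ncard_left (H.neighborSet i) {l | (v, l) ∈ S}
  omega

theorem ncard_eq_sum_ncard_layer {V W : Type*} [Finite V] [Fintype W] (S : Set (V × W)) :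
    S.ncard = ∑ i, {v | (v, i) ∈ S}.ncard := by
  classical
  have := Fintype.ofFinite V
  simp only [Set.ncard_eq_toFinset_card']
  rw [Finset.card_eq_sum_card_fiberwise (f := Prod.snd) (t := Finset.univ) (by simp)]
  refine Finset.sum_congr rfl fun i _ => ?_
  refine (Finset.card_bij (fun v _ => (v, i)) ?_ ?_ ?_).symm
  · simp
  · simp
  · rintro ⟨v, j⟩ h
    simp only [Finset.mem_filter, Set.mem_toFinset] at h
    obtain ⟨h, rfl⟩ := h
    exact ⟨v, by simpa using h, rfl⟩

theorem Finset.sum_range_two_mul_add_one {M : Type*} [AddCommMonoid M] (f : ℕ → M) (k : ℕ) :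
    ∑ i ∈ range (2 * k + 1), f i =
      f 0 + ∑ j ∈ range k, (f (2 * j + 1) + f (2 * j + 2)) := by
  induction k with
  | zero => simp
  | succ k ih =>
    rw [show 2 * (k + 1) + 1 = 2 * k + 1 + 1 + 1 by ring, sum_range_succ, sum_range_succ, ih,
      sum_range_succ]
    simp only [add_assoc]

theorem ncard_pathGraph_neighborSet_le_two {n : ℕ} (i : Fin n) :
    ((pathGraph n).neighborSet i).ncard ≤ 2 := by
  have himage : (Fin.val '' (pathGraph n).neighborSet i) ⊆ {(i : ℕ) - 1, (i : ℕ) + 1} := by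
    rintro _ ⟨j, hj, rfl⟩
    rw [mem_neighborSet, pathGraph_adj] at hj
    simp only [Set.mem_insert_iff, Set.mem_singleton_iff]
    omega
  rw [← Set.ncard_image_of_injective _ Fin.val_injective]
  exact (Set.ncard_le_ncard himage).trans ((Set.ncard_insert_le _ _).trans (by simp))

theorem ncard_pathGraph_neighborSet_zero_le_one (n : ℕ) :
    ((pathGraph (n + 1)).neighborSet 0).ncard ≤ 1 := by
  rw [Set.ncard_le_one_iff]
  intro a b ha hb
  rw [mem_neighborSet, pathGraph_adj] at ha hb
  simp only [Fin.val_zero] at ha hb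
  exact Fin.ext (by omega)

theorem globalOffensiveAllianceNumber_pathGraph_odd_le {k : ℕ} (hk : 1 ≤ k) :
    globalOffensiveAllianceNumber (pathGraph (2 * k + 1)) ≤ k := by
  have hS : IsGlobalOffensiveAlliance (pathGraph (2 * k + 1)) {i | (i : ℕ) % 2 = 1} := by
    intro i hi
    rw [Set.mem_ofPred_eq] at hi
    have hout : (pathGraph (2 * k + 1)).neighborSet i \ {i | (i : ℕ) % 2 = 1} = ∅ := by
      refine Set.sdiff_eq_empty.2 fun j hj => ?_
      rw [mem_neighborSet, pathGraph_adj] at hj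
      rw [Set.mem_ofPred_eq]
      omega
    rw [hout, Set.ncard_empty, zero_add]
    refine (Set.ncard_pos (Set.toFinite _)).2 ?_
    have hlt := i.isLt
    by_cases h0 : (i : ℕ) = 0
    · refine ⟨⟨1, by omega⟩, ?_, ?_⟩
      · rw [mem_neighborSet, pathGraph_adj]
        left
        simp [h0]
      · simp
    · refine ⟨⟨i - 1, by omega⟩, ?_, ?_⟩
      · rw [mem_neighborSet, pathGraph_adj]
        right
        simp only
        omega
      · simp only [Set.mem_ofPred_eq]
        omega
  refine (globalOffensiveAllianceNumber_le hS).trans ?_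
  have himage : (Fin.val '' {i : Fin (2 * k + 1) | (i : ℕ) % 2 = 1}) ⊆
      ((Finset.range k).image fun j => 2 * j + 1 : Finset ℕ) := by
    rintro _ ⟨i, hi, rfl⟩
    have hlt := i.isLt
    simp only [Set.mem_ofPred_eq] at hi
    simp only [Finset.coe_image, Finset.coe_range, Set.mem_image, Set.mem_Iio]
    exact ⟨(i : ℕ) / 2, by omega, by omega⟩
  rw [← Set.ncard_image_of_injective _ Fin.val_injective]
  refine (Set.ncard_le_ncard himage).trans ?_
  rw [Set.ncard_coe_finset]
  exact Finset.card_image_le.trans (Finset.card_range k).le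

theorem stmt5 {V : Type*} [Fintype V] [Nonempty V] (G : SimpleGraph V)
    (hG : ∀ v : V, ∃ u : V, G.Adj v u) (k : ℕ) (hk : 1 ≤ k) :
    globalOffensiveAllianceNumber (G.boxProd (pathGraph (2 * k + 1))) >
      globalOffensiveAllianceNumber G * globalOffensiveAllianceNumber (pathGraph (2 * k + 1)) := by
  obtain ⟨S, hS, hcard⟩ :=
    exists_isGlobalOffensiveAlliance_ncard_eq (G.boxProd (pathGraph (2 * k + 1)))
  let layer : ℕ → Set V := fun i => {v | ∃ h : i < 2 * k + 1, (v, ⟨i, h⟩) ∈ S}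
  have hlayer (i : Fin (2 * k + 1)) : {v | (v, i) ∈ S} = layer i := by
    ext v
    exact ⟨fun h => ⟨i.isLt, h⟩, fun ⟨_, h⟩ => h⟩
  have hsum : S.ncard = (layer 0).ncard +
      ∑ j ∈ Finset.range k, ((layer (2 * j + 1)).ncard + (layer (2 * j + 2)).ncard) := by
    rw [ncard_eq_sum_ncard_layer, ← Finset.sum_range_two_mul_add_one fun i => (layer i).ncard,
      ← Fin.sum_univ_eq_sum_range fun i => (layer i).ncard]
    simp only [hlayer]
  have hzero : 0 < (layer 0).ncard := by
    have h := hS.layer_nonempty hG (ncard_pathGraph_neighborSet_zero_le_one (2 * k))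
    rw [hlayer] at h
    exact (Set.ncard_pos (Set.toFinite _)).2 h
  have hpair : ∀ j ∈ Finset.range k, globalOffensiveAllianceNumber G ≤
      (layer (2 * j + 1)).ncard + (layer (2 * j + 2)).ncard := by
    intro j hj
    rw [Finset.mem_range] at hj
    have hadj : (pathGraph (2 * k + 1)).Adj ⟨2 * j + 1, by omega⟩ ⟨2 * j + 2, by omega⟩ :=
      pathGraph_adj.2 (Or.inl rfl)
    have h := hS.union_layers hadj (ncard_pathGraph_neighborSet_le_two _)
    rw [hlayer, hlayer] at h
    exact (globalOffensiveAllianceNumber_le h).trans (Set.ncard_union_le _ _)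
  have hpairs := Finset.card_nsmul_le_sum _ _ _ hpair
  rw [Finset.card_range, smul_eq_mul] at hpairs
  have hpath := Nat.mul_le_mul_left (globalOffensiveAllianceNumber G)
    (globalOffensiveAllianceNumber_pathGraph_odd_le hk)
  rw [mul_comm _ (globalOffensiveAllianceNumber G)] at hpairs
  omega
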